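/- Let 0 ≤ p ≤ 1 and let ρ(p)₂ be the two-qubit density matrix which, in the computational basis {|00⟩, |01⟩, |10⟩, |11⟩}, has entries ρ₀₀,₀₀ = ρ₁₁,₁₁ = 1/2, ρ₀₀,₁₁ = ρ₁₁,₀₀ = p/2, and all other entries zero. Then its entanglement of formation (with entropies in bits, i.e. logarithms base 2) equals h((1 + √(1 − p²))/2), where h(x) = −x log₂ x − (1 − x) log₂(1 − x). -/

import Mathlib

open scoped Kronecker ComplexOrder

/-- Von Neumann entropy in bits (logarithm base 2) of a matrix, via its eigenvalues
(`0` if the matrix is not Hermitian; `Real.logb 2 0 = 0` handles zero eigenvalues). -/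
noncomputable def vN2 {n : Type*} [Fintype n] [DecidableEq n] (ρ : Matrix n n ℂ) : ℝ :=
  if h : ρ.IsHermitian then -∑ i, h.eigenvalues i * Real.logb 2 (h.eigenvalues i) else 0

/-- Partial trace over the second tensor factor. -/
noncomputable def ptraceB {A B : Type*} [Fintype B] (ρ : Matrix (A × B) (A × B) ℂ) :
    Matrix A A ℂ := Matrix.of fun a a' => ∑ b, ρ (a, b) (a', b)

/-- Partial trace over the first tensor factor. -/
noncomputable def ptraceA {A B : Type*} [Fintype A] (ρ : Matrix (A × B) (A × B) ℂ) :
    Matrix B B ℂ := Matrix.of fun b b' => ∑ a, ρ (a, b) (a, b')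

/-- Partial trace over the third factor of a tripartite system `A × B × C`. -/
noncomputable def ptraceC3 {A B C : Type*} [Fintype C] (ρ : Matrix (A × B × C) (A × B × C) ℂ) :
    Matrix (A × B) (A × B) ℂ := Matrix.of fun x y => ∑ c, ρ (x.1, x.2, c) (y.1, y.2, c)

/-- Partial trace over the second factor of a tripartite system `A × B × C`. -/
noncomputable def ptraceB3 {A B C : Type*} [Fintype B] (ρ : Matrix (A × B × C) (A × B × C) ℂ) :
    Matrix (A × C) (A × C) ℂ := Matrix.of fun x y => ∑ b, ρ (x.1, b, x.2) (y.1, b, y.2)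

/-- Entanglement of formation with entropies in bits: infimum of the average local
entropy (base-2) over finite pure-state ensembles realizing `ρAB`. -/
noncomputable def EoF2 {A B : Type*} [Fintype A] [DecidableEq A] [Fintype B] [DecidableEq B]
    (ρAB : Matrix (A × B) (A × B) ℂ) : ℝ :=
  sInf { x : ℝ | ∃ (n : ℕ) (p : Fin n → ℝ) (ψ : Fin n → (A × B → ℂ)),
    (∀ i, 0 ≤ p i) ∧ (∑ i, p i = 1) ∧ (∀ i, ∑ v, ‖ψ i v‖ ^ 2 = 1) ∧
    ρAB = ∑ i, (p i : ℂ) • Matrix.vecMulVec (ψ i) (star (ψ i)) ∧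
    x = ∑ i, p i * vN2 (ptraceB (Matrix.vecMulVec (ψ i) (star (ψ i)))) }

/-- Binary entropy (base 2), with `0 log₂ 0 := 0`. -/
noncomputable def binEnt (x : ℝ) : ℝ := -(x * Real.logb 2 x) - (1 - x) * Real.logb 2 (1 - x)

/-- The entanglement entropy, in nats, of a two-qubit pure state of concurrence `c`. -/
noncomputable def concurrenceEntropy (c : ℝ) : ℝ :=
  Real.binEntropy ((1 + √(1 - c ^ 2)) / 2)

theorem binEnt_eq_binEntropy_div (x : ℝ) : binEnt x = Real.binEntropy x / Real.log 2 := by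
  simp only [binEnt, Real.binEntropy, Real.logb, Real.log_inv]
  ring

theorem concurrenceEntropy_two_mul_mul {a b : ℝ} (h : a ^ 2 + b ^ 2 = 1) :
    concurrenceEntropy (2 * (a * b)) = Real.binEntropy (a ^ 2) := by
  have hsq : 1 - (2 * (a * b)) ^ 2 = (a ^ 2 - b ^ 2) ^ 2 := by
    linear_combination (-1 - (a ^ 2 + b ^ 2)) * h
  rw [concurrenceEntropy, hsq, Real.sqrt_sq_eq_abs]
  rcases le_total 0 (a ^ 2 - b ^ 2) with hs | hs
  · rw [abs_of_nonneg hs]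
    congr 1
    linear_combination (-1 / 2) * h
  · rw [abs_of_nonpos hs, ← Real.binEntropy_one_sub]
    congr 1
    linear_combination (-1 / 2) * h

theorem monotoneOn_concurrenceEntropy :
    MonotoneOn concurrenceEntropy (Set.Icc 0 1) := by
  intro c hc d hd hcd
  have hle : √(1 - d ^ 2) ≤ √(1 - c ^ 2) :=
    Real.sqrt_le_sqrt (by nlinarith [hc.1])
  have h1 : √(1 - c ^ 2) ≤ 1 := Real.sqrt_le_one.mpr (by nlinarith)
  have h0 := Real.sqrt_nonneg (1 - d ^ 2)
  apply Real.binEntropy_strictAntiOn.antitoneOn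
  · constructor <;> linarith
  · constructor <;> linarith
  · linarith

theorem convexOn_concurrenceEntropy :
    ConvexOn ℝ (Set.Icc 0 1) concurrenceEntropy := by
  have hx : ∀ c ∈ Set.Ioo (0 : ℝ) 1, 0 < √(1 - c ^ 2) ∧ √(1 - c ^ 2) < 1 ∧
      √(1 - c ^ 2) ^ 2 = 1 - c ^ 2 := by
    intro c hc
    have hpos : 0 < 1 - c ^ 2 := by nlinarith [hc.1, hc.2]
    refine ⟨Real.sqrt_pos.mpr hpos, ?_, Real.sq_sqrt hpos.le⟩
    rw [Real.sqrt_lt' one_pos]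
    nlinarith [hc.1]
  have hdx : ∀ c ∈ Set.Ioo (0 : ℝ) 1,
      HasDerivAt (fun c : ℝ => √(1 - c ^ 2)) (-c / √(1 - c ^ 2)) c := by
    intro c hc
    have hpos : 0 < 1 - c ^ 2 := by nlinarith [hc.1, hc.2]
    convert ((hasDerivAt_pow 2 c).const_sub 1).sqrt hpos.ne' using 1
    have := (hx c hc).1.ne'
    push_cast
    field_simp
  refine convexOn_of_hasDerivWithinAt2_nonneg (convex_Icc 0 1)
    (f' := fun c => c / (2 * √(1 - c ^ 2)) *
      (Real.log (1 + √(1 - c ^ 2)) - Real.log (1 - √(1 - c ^ 2))))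
    (f'' := fun c => ((Real.log (1 + √(1 - c ^ 2)) - Real.log (1 - √(1 - c ^ 2))) / 2
      - √(1 - c ^ 2)) / √(1 - c ^ 2) ^ 3) ?_ ?_ ?_ ?_
  · unfold concurrenceEntropy
    fun_prop
  · rw [interior_Icc]
    intro c hc
    obtain ⟨h0, h1, hsq⟩ := hx c hc
    have hinner := ((hdx c hc).const_add 1).div_const 2
    have hout := Real.hasDerivAt_binEntropy
      (p := (1 + √(1 - c ^ 2)) / 2) (by positivity) (by linarith)
    refine HasDerivAt.hasDerivWithinAt ?_
    refine (hout.comp c hinner).congr_deriv ?_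
    rw [show 1 - (1 + √(1 - c ^ 2)) / 2 = (1 - √(1 - c ^ 2)) / 2 by ring,
      Real.log_div (by linarith) two_ne_zero, Real.log_div (by linarith) two_ne_zero]
    field_simp
    ring
  · rw [interior_Icc]
    intro c hc
    obtain ⟨h0, h1, hsq⟩ := hx c hc
    have hd := hdx c hc
    have hl1 := (hd.const_add 1).log (by linarith)
    have hl2 := (hd.const_sub 1).log (by linarith)
    have hq : HasDerivAt (fun c : ℝ => c / (2 * √(1 - c ^ 2))) _ c :=
      (hasDerivAt_id' c).div (hd.const_mul 2) (by positivity)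
    refine HasDerivAt.hasDerivWithinAt ?_
    refine (hq.mul (hl1.sub hl2)).congr_deriv ?_
    have hc2 : c ^ 2 = (1 - √(1 - c ^ 2)) * (1 + √(1 - c ^ 2)) := by linarith
    have hp : 1 + √(1 - c ^ 2) ≠ 0 := by positivity
    have hm : 1 - √(1 - c ^ 2) ≠ 0 := by linarith
    simp only [Pi.sub_apply]
    generalize √(1 - c ^ 2) = x at *
    field_simp
    ring_nf
    simp only [hc2]
    ring
  · rw [interior_Icc]
    intro c hc
    obtain ⟨h0, h1, -⟩ := hx c hc
    have hlog := Real.sum_range_le_log_div h0.le h1 1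
    rw [Real.log_div (by linarith) (by linarith)] at hlog
    simp only [Finset.sum_range_one] at hlog
    norm_num at hlog
    apply div_nonneg _ (by positivity)
    linarith

theorem vN2_diagonal_fin_two {a b : ℝ} (hab : a + b = 1) :
    vN2 (Matrix.diagonal ![(a : ℂ), (b : ℂ)]) = Real.binEntropy a / Real.log 2 := by
  have h : (Matrix.diagonal ![(a : ℂ), (b : ℂ)]).IsHermitian := by
    rw [Matrix.isHermitian_diagonal_iff]
    intro i
    fin_cases i <;> simp [IsSelfAdjoint]
  have htr := h.trace_eq_sum_eigenvalues
  have hdet := h.det_eq_prod_eigenvalues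
  simp only [Matrix.trace_diagonal, Matrix.det_diagonal, Fin.sum_univ_two, Fin.prod_univ_two,
    Matrix.cons_val_zero, Matrix.cons_val_one] at htr hdet
  rw [vN2, dif_pos h, Fin.sum_univ_two]
  generalize h.eigenvalues 0 = x at *
  generalize h.eigenvalues 1 = y at *
  replace htr : a + b = x + y := Complex.ofReal_injective (by push_cast; exact htr)
  replace hdet : a * b = x * y := Complex.ofReal_injective (by push_cast; exact hdet)
  obtain rfl : y = 1 - x := by linarith
  have hent : -(x * Real.logb 2 x + (1 - x) * Real.logb 2 (1 - x)) =
      Real.binEntropy x / Real.log 2 := by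
    rw [← binEnt_eq_binEntropy_div, binEnt]
    ring
  rw [hent]
  have hroot : (x - a) * (x - b) = 0 := by linear_combination (-x) * htr + hdet
  rcases mul_eq_zero.mp hroot with hxa | hxb
  · rw [sub_eq_zero.mp hxa]
  · rw [show x = 1 - a by linarith, Real.binEntropy_one_sub]

theorem vN2_ptraceB_schmidt {ψ : Fin 2 × Fin 2 → ℂ} (hψ : ∑ v, ‖ψ v‖ ^ 2 = 1)
    (h01 : ψ (0, 1) = 0) (h10 : ψ (1, 0) = 0) :
    vN2 (ptraceB (Matrix.vecMulVec ψ (star ψ))) =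
      concurrenceEntropy (2 * (‖ψ (0, 0)‖ * ‖ψ (1, 1)‖)) / Real.log 2 := by
  simp only [Fintype.sum_prod_type, Fin.sum_univ_two, h01, h10] at hψ
  have hsum : ‖ψ (0, 0)‖ ^ 2 + ‖ψ (1, 1)‖ ^ 2 = 1 := by simpa using hψ
  rw [concurrenceEntropy_two_mul_mul hsum, ← vN2_diagonal_fin_two hsum]
  congr 1
  ext i j
  fin_cases i <;> fin_cases j <;>
    simp [ptraceB, Matrix.vecMulVec_apply, h01, h10, Complex.mul_conj']

theorem concurrenceEntropy_le_of_ensemble {p : ℝ} (hp0 : 0 ≤ p) (hp1 : p ≤ 1)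
    {ρ : Matrix (Fin 2 × Fin 2) (Fin 2 × Fin 2) ℂ}
    (h01 : ρ (0, 1) (0, 1) = 0) (h10 : ρ (1, 0) (1, 0) = 0)
    (hoff : ρ (0, 0) (1, 1) = (p : ℂ) / 2)
    {n : ℕ} {w : Fin n → ℝ} {ψ : Fin n → (Fin 2 × Fin 2 → ℂ)}
    (hw : ∀ i, 0 ≤ w i) (hw1 : ∑ i, w i = 1) (hψ : ∀ i, ∑ v, ‖ψ i v‖ ^ 2 = 1)
    (hρ : ρ = ∑ i, (w i : ℂ) • Matrix.vecMulVec (ψ i) (star (ψ i))) :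
    concurrenceEntropy p / Real.log 2 ≤
      ∑ i, w i * vN2 (ptraceB (Matrix.vecMulVec (ψ i) (star (ψ i)))) := by
  have hentry : ∀ u v, ρ u v = ∑ i, (w i : ℂ) * (ψ i u * star (ψ i v)) := by
    intro u v
    rw [hρ]
    simp [Matrix.sum_apply, Matrix.vecMulVec_apply]
  have hvanish : ∀ u, ρ u u = 0 → ∀ i, w i ≠ 0 → ψ i u = 0 := by
    intro u hu i hi
    rw [hentry] at hu
    have hreal : ∑ i, w i * ‖ψ i u‖ ^ 2 = 0 := by
      have hcast : ((∑ i, w i * ‖ψ i u‖ ^ 2 : ℝ) : ℂ) = 0 := by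
        rw [← hu]
        push_cast
        exact Finset.sum_congr rfl fun i _ => by rw [← Complex.mul_conj']; rfl
      exact_mod_cast hcast
    rw [Finset.sum_eq_zero_iff_of_nonneg fun i _ => mul_nonneg (hw i) (sq_nonneg _)] at hreal
    simpa [hi] using hreal i (Finset.mem_univ i)
  set c : Fin n → ℝ := fun i => 2 * (‖ψ i (0, 0)‖ * ‖ψ i (1, 1)‖) with hc
  have hterm : ∀ i, w i * vN2 (ptraceB (Matrix.vecMulVec (ψ i) (star (ψ i)))) =
      w i * concurrenceEntropy (c i) / Real.log 2 := by
    intro i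
    by_cases hi : w i = 0
    · simp [hi]
    · rw [vN2_ptraceB_schmidt (hψ i) (hvanish _ h01 i hi) (hvanish _ h10 i hi), mul_div_assoc]
  have hcmem : ∀ i ∈ Finset.univ, c i ∈ Set.Icc (0 : ℝ) 1 := by
    intro i _
    refine ⟨by positivity, ?_⟩
    have hi := hψ i
    simp only [Fintype.sum_prod_type, Fin.sum_univ_two] at hi
    simp only [hc]
    nlinarith [sq_nonneg (‖ψ i (0, 0)‖ - ‖ψ i (1, 1)‖), sq_nonneg ‖ψ i (0, 1)‖,
      sq_nonneg ‖ψ i (1, 0)‖]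
  have hple : p ≤ ∑ i, w i • c i := by
    have hnorm : ‖(p : ℂ) / 2‖ ≤ ∑ i, w i * (‖ψ i (0, 0)‖ * ‖ψ i (1, 1)‖) := by
      rw [← hoff, hentry]
      refine (norm_sum_le _ _).trans_eq (Finset.sum_congr rfl fun i _ => ?_)
      rw [norm_mul, norm_mul, norm_star, Complex.norm_real, Real.norm_of_nonneg (hw i)]
    rw [norm_div, Complex.norm_real, Real.norm_of_nonneg hp0, Complex.norm_two] at hnorm
    have hsum : ∑ i, w i • c i = 2 * ∑ i, w i * (‖ψ i (0, 0)‖ * ‖ψ i (1, 1)‖) := by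
      rw [Finset.mul_sum]
      exact Finset.sum_congr rfl fun i _ => by simp only [hc, smul_eq_mul]; ring
    linarith
  have hmem := (convex_Icc (0 : ℝ) 1).sum_mem (fun i _ => hw i) hw1 hcmem
  have hjensen := convexOn_concurrenceEntropy.map_sum_le (fun i _ => hw i) hw1 hcmem
  rw [Finset.sum_congr rfl fun i _ => hterm i, ← Finset.sum_div]
  have hlog : 0 ≤ Real.log 2 := Real.log_nonneg one_le_two
  gcongr
  exact (monotoneOn_concurrenceEntropy ⟨hp0, hp1⟩ hmem hple).trans hjensen

/-- for `0 ≤ p ≤ 1`, the two-qubit density matrix with entries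
`ρ₀₀,₀₀ = ρ₁₁,₁₁ = 1/2`, `ρ₀₀,₁₁ = ρ₁₁,₀₀ = p/2` (all others zero) has entanglement
of formation (in bits) `h((1 + √(1 − p²))/2)`. -/
theorem eof_dephased_bell_state
    (p : ℝ) (hp0 : 0 ≤ p) (hp1 : p ≤ 1)
    (ρ : Matrix (Fin 2 × Fin 2) (Fin 2 × Fin 2) ℂ)
    (hρ : ρ = Matrix.of fun i j =>
      if i = ((0 : Fin 2), (0 : Fin 2)) ∧ j = ((0 : Fin 2), (0 : Fin 2)) then 1 / 2
      else if i = ((1 : Fin 2), (1 : Fin 2)) ∧ j = ((1 : Fin 2), (1 : Fin 2)) then 1 / 2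
      else if i = ((0 : Fin 2), (0 : Fin 2)) ∧ j = ((1 : Fin 2), (1 : Fin 2)) then (p : ℂ) / 2
      else if i = ((1 : Fin 2), (1 : Fin 2)) ∧ j = ((0 : Fin 2), (0 : Fin 2)) then (p : ℂ) / 2
      else 0) :
    EoF2 ρ = binEnt ((1 + Real.sqrt (1 - p ^ 2)) / 2) := by

  rw [binEnt_eq_binEntropy_div, ← concurrenceEntropy]
  refine IsLeast.csInf_eq ⟨?_, ?_⟩
  · set s : ℝ := √(1 - p ^ 2) with hs
    have hs0 : 0 ≤ s := Real.sqrt_nonneg _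
    have hssq : s ^ 2 = 1 - p ^ 2 := Real.sq_sqrt (by nlinarith)
    have hs1 : s ≤ 1 := by nlinarith
    set a : ℝ := √((1 + s) / 2) with ha
    set b : ℝ := √((1 - s) / 2) with hb
    have ha2 : a ^ 2 = (1 + s) / 2 := Real.sq_sqrt (by linarith)
    have hb2 : b ^ 2 = (1 - s) / 2 := Real.sq_sqrt (by linarith)
    have ha0 : 0 ≤ a := Real.sqrt_nonneg _
    have hb0 : 0 ≤ b := Real.sqrt_nonneg _
    have hab : 2 * (a * b) = p := by
      rw [← sq_eq_sq₀ (by positivity) hp0]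
      linear_combination 4 * b ^ 2 * ha2 + 2 * (1 + s) * hb2 - hssq
    have hab' : (a : ℂ) * b = p / 2 := by
      rw [← hab]
      push_cast
      ring
    have hsum : (a : ℂ) * a + b * b = 1 := by
      have : a * a + b * b = 1 := by linear_combination ha2 + hb2
      exact_mod_cast this
    set ψ : Fin 2 → (Fin 2 × Fin 2 → ℂ) := fun k v =>
      if v = (0, 0) then (if k = 0 then (a : ℂ) else b)
      else if v = (1, 1) then (if k = 0 then (b : ℂ) else a) else 0 with hψdef
    have hψ : ∀ k, ∑ v, ‖ψ k v‖ ^ 2 = 1 := by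
      intro k
      fin_cases k <;>
        simp [hψdef, Fintype.sum_prod_type, Fin.sum_univ_two, ha2, hb2] <;> ring
    refine ⟨2, fun _ => 1 / 2, ψ, fun _ => by norm_num, by norm_num, hψ, ?_, ?_⟩
    · rw [hρ]
      ext ⟨i, i'⟩ ⟨j, j'⟩
      fin_cases i <;> fin_cases i' <;> fin_cases j <;> fin_cases j' <;>
        simp [hψdef, Matrix.vecMulVec_apply, Fin.sum_univ_two] <;>
        first
          | linear_combination (-1 / 2) * hsum
          | linear_combination -hab'
    · rw [Fin.sum_univ_two, vN2_ptraceB_schmidt (hψ 0) (by simp [hψdef]) (by simp [hψdef]),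
        vN2_ptraceB_schmidt (hψ 1) (by simp [hψdef]) (by simp [hψdef])]
      simp only [hψdef]
      simp [abs_of_nonneg ha0, abs_of_nonneg hb0, mul_comm b a, hab]
      ring
  · rintro x ⟨n, w, ψ, hw, hw1, hψ, hens, rfl⟩
    exact concurrenceEntropy_le_of_ensemble hp0 hp1 (by simp [hρ]) (by simp [hρ])
      (by simp [hρ]) hw hw1 hψ hens
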